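/- In the nilHecke algebra NH_n, the idempotent e_n := x_1^{n−1} x_2^{n−2} ⋯ x_{n−1} ψ_{w_0} is a primitive idempotent: e_n ≠ 0, and there do not exist nonzero idempotents f, g ∈ NH_n with fg = gf = 0 and e_n = f + g. -/

import Mathlib

open Classical

noncomputable section

/-- Generators of the nilHecke algebra `NH_n`: dots `x j` and crossings `psi j`
(crossing strands `j, j+1`, 0-indexed). -/
inductive NHGen (n : ℕ) : Type
  | x : Fin n → NHGen n
  | psi : Fin (n - 1) → NHGen n

/-- The left strand position of the crossing `ψ_j`. -/
def lpos {n : ℕ} (j : Fin (n - 1)) : Fin n := Fin.castLE (n.sub_le 1) j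

/-- The right strand position of the crossing `ψ_j`. -/
def rpos {n : ℕ} (j : Fin (n - 1)) : Fin n :=
  ⟨j.val + 1, by have := j.isLt; omega⟩

/-- The generator `x_j` of the free algebra on the nilHecke generators. -/
def XNf (𝕜 : Type) [Field 𝕜] (n : ℕ) (j : Fin n) : FreeAlgebra 𝕜 (NHGen n) :=
  FreeAlgebra.ι 𝕜 (NHGen.x j)

/-- The generator `ψ_j` of the free algebra on the nilHecke generators. -/
def PNf (𝕜 : Type) [Field 𝕜] (n : ℕ) (j : Fin (n - 1)) : FreeAlgebra 𝕜 (NHGen n) :=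
  FreeAlgebra.ι 𝕜 (NHGen.psi j)

/-- The defining relations of the nilHecke algebra `NH_n`. -/
inductive NHRel (𝕜 : Type) [Field 𝕜] (n : ℕ) :
    FreeAlgebra 𝕜 (NHGen n) → FreeAlgebra 𝕜 (NHGen n) → Prop
  | xx (j k : Fin n) :
      NHRel 𝕜 n (XNf 𝕜 n j * XNf 𝕜 n k) (XNf 𝕜 n k * XNf 𝕜 n j)
  | psix (j : Fin (n - 1)) (k : Fin n) (h1 : k ≠ lpos j) (h2 : k ≠ rpos j) :
      NHRel 𝕜 n (PNf 𝕜 n j * XNf 𝕜 n k) (XNf 𝕜 n k * PNf 𝕜 n j)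
  | psipsi (j k : Fin (n - 1)) (h : (j : ℕ) + 1 < (k : ℕ)) :
      NHRel 𝕜 n (PNf 𝕜 n j * PNf 𝕜 n k) (PNf 𝕜 n k * PNf 𝕜 n j)
  | psisq (j : Fin (n - 1)) :
      NHRel 𝕜 n (PNf 𝕜 n j * PNf 𝕜 n j) 0
  | braid (j k : Fin (n - 1)) (h : (j : ℕ) + 1 = (k : ℕ)) :
      NHRel 𝕜 n (PNf 𝕜 n j * PNf 𝕜 n k * PNf 𝕜 n j)
        (PNf 𝕜 n k * PNf 𝕜 n j * PNf 𝕜 n k)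
  | dot1 (j : Fin (n - 1)) :
      NHRel 𝕜 n (XNf 𝕜 n (lpos j) * PNf 𝕜 n j - PNf 𝕜 n j * XNf 𝕜 n (rpos j)) 1
  | dot2 (j : Fin (n - 1)) :
      NHRel 𝕜 n (PNf 𝕜 n j * XNf 𝕜 n (lpos j) - XNf 𝕜 n (rpos j) * PNf 𝕜 n j) 1

/-- The nilHecke algebra `NH_n`. -/
abbrev NH (𝕜 : Type) [Field 𝕜] (n : ℕ) := RingQuot (NHRel 𝕜 n)

/-- The canonical map from the free algebra to `NH_n`. -/
def nhMk (𝕜 : Type) [Field 𝕜] (n : ℕ) : FreeAlgebra 𝕜 (NHGen n) →ₐ[𝕜] NH 𝕜 n :=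
  RingQuot.mkAlgHom 𝕜 (NHRel 𝕜 n)

/-- The dot `x_j` in `NH_n`. -/
def xN (𝕜 : Type) [Field 𝕜] (n : ℕ) (j : Fin n) : NH 𝕜 n := nhMk 𝕜 n (XNf 𝕜 n j)

/-- The crossing `ψ_j` in `NH_n`. -/
def pN (𝕜 : Type) [Field 𝕜] (n : ℕ) (j : Fin (n - 1)) : NH 𝕜 n := nhMk 𝕜 n (PNf 𝕜 n j)

/-- The adjacent transposition `s_j = (j, j+1)` of `𝔖_n` (0-indexed). -/
def sSwap {n : ℕ} (j : Fin (n - 1)) : Equiv.Perm (Fin n) :=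
  Equiv.swap (lpos j) (rpos j)


section Statement56

/-- The dot part `x_1^{n−1} x_2^{n−2} ⋯ x_{n−1}` of the idempotent `e_n` (0-indexed:
the `j`-th dot appears with exponent `n − 1 − j`). -/
def nhDots (𝕜 : Type) [Field 𝕜] (n : ℕ) : NH 𝕜 n :=
  ((List.finRange n).map (fun j => xN 𝕜 n j ^ (n - 1 - j.val))).prod

/-- `e_n := x_1^{n−1} x_2^{n−2} ⋯ x_{n−1} ψ_{w_0}`, where `ψ_{w_0}` is given by a
word `L` of crossings. -/
def nhE (𝕜 : Type) [Field 𝕜] (n : ℕ) (L : List (Fin (n - 1))) : NH 𝕜 n :=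
  nhDots 𝕜 n * (L.map (pN 𝕜 n)).prod

/-! ### Words in the nilCoxeter relations -/

section NilCoxeter

variable {A : Type*} [MonoidWithZero A]

/-- The relations satisfied by the crossings of the nilHecke algebra, for a sequence of elements. -/
structure IsNilCoxeter (p : ℕ → A) : Prop where
  sq (j : ℕ) : p j * p j = 0
  comm (j k : ℕ) (h : j + 1 < k) : p j * p k = p k * p j
  braid (j : ℕ) : p j * p (j + 1) * p j = p (j + 1) * p j * p (j + 1)

/-- The descending product `p (a + r - 1) * ⋯ * p (a + 1) * p a`. -/
def descProd (p : ℕ → A) (a : ℕ) : ℕ → A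
  | 0 => 1
  | r + 1 => p (a + r) * descProd p a r

lemma descProd_succ_right (p : ℕ → A) (a r : ℕ) :
    descProd p a (r + 1) = descProd p (a + 1) r * p a := by
  induction r with
  | zero => simp [descProd]
  | succ r ih =>
    rw [descProd, ih, descProd, mul_assoc, show a + 1 + r = a + (r + 1) by omega]

namespace IsNilCoxeter

variable {p : ℕ → A} (hp : IsNilCoxeter p)
include hp

lemma descProd_mul_last (a r : ℕ) : descProd p a (r + 1) * p a = 0 := by
  rw [descProd_succ_right, mul_assoc, hp.sq, mul_zero]

lemma descProd_mul_of_lt {a j : ℕ} (h : j + 1 < a) (r : ℕ) :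
    descProd p a r * p j = p j * descProd p a r := by
  induction r with
  | zero => simp [descProd]
  | succ r ih =>
    rw [descProd, mul_assoc, ih, ← mul_assoc, ← hp.comm j (a + r) (by omega), mul_assoc]

lemma descProd_mul_of_gt {a j r : ℕ} (h : a + r < j) :
    descProd p a r * p j = p j * descProd p a r := by
  induction r with
  | zero => simp [descProd]
  | succ r ih =>
    rw [descProd, mul_assoc, ih (by omega), ← mul_assoc, hp.comm (a + r) j (by omega), mul_assoc]

lemma descProd_mul_of_mem {a j r : ℕ} (h₁ : a ≤ j) (h₂ : j + 1 < a + r) :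
    descProd p a r * p (j + 1) = p j * descProd p a r := by
  induction r with
  | zero => omega
  | succ r ih =>
    rcases Nat.lt_or_ge (j + 1) (a + r) with h | h
    · rw [descProd, mul_assoc, ih h, ← mul_assoc, ← hp.comm j (a + r) h, mul_assoc]
    · obtain rfl | ⟨s, rfl⟩ : r = 0 ∨ ∃ s, r = s + 1 := by
        cases r <;> simp
      · omega
      · obtain rfl : j = a + s := by omega
        rw [descProd, descProd, mul_assoc, mul_assoc,
          hp.descProd_mul_of_gt (show a + s < a + s + 1 by omega), ← mul_assoc, ← mul_assoc,
          show a + (s + 1) = a + s + 1 by omega, ← hp.braid]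
        simp only [mul_assoc]

lemma prod_eq_zero_or_factor (m : ℕ) (L : List ℕ) (hL : ∀ j ∈ L, j < m + 1) :
    (L.map p).prod = 0 ∨ ∃ (L' : List ℕ) (a r : ℕ), (∀ j ∈ L', j < m) ∧ a + r = m + 1 ∧
      L.length = L'.length + r ∧ (L.map p).prod = (L'.map p).prod * descProd p a r := by
  induction L using List.reverseRecOn with
  | nil => exact Or.inr ⟨[], m + 1, 0, by simp, rfl, by simp, by simp [descProd]⟩
  | append_singleton L j ih =>
    have hj : j < m + 1 := hL j (by simp)
    have snoc {L' : List ℕ} {k : ℕ} (hL' : ∀ i ∈ L', i < m) (hk : k < m) :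
        ∀ i ∈ L' ++ [k], i < m := by
      simpa [or_imp, forall_and] using ⟨hL', hk⟩
    obtain h | ⟨L', a, r, hL', har, hlen, h⟩ := ih fun i hi => hL i (by simp [hi])
    · simp [h]
    · simp only [List.map_append, List.prod_append, List.map_singleton, List.prod_singleton,
        List.length_append, List.length_singleton, h, mul_assoc]
      rcases lt_trichotomy j a with hja | rfl | hja
      · rcases Nat.lt_or_ge (j + 1) a with hja' | hja'
        · exact Or.inr ⟨L' ++ [j], a, r, snoc hL' (by omega), har, by simp; omega,
            by simp [hp.descProd_mul_of_lt hja', mul_assoc]⟩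
        · obtain rfl : a = j + 1 := by omega
          exact Or.inr ⟨L', j, r + 1, hL', by omega, by omega,
            by rw [descProd_succ_right]⟩
      · obtain ⟨s, rfl⟩ : ∃ s, r = s + 1 := ⟨r - 1, by omega⟩
        exact Or.inl (by rw [hp.descProd_mul_last, mul_zero])
      · obtain ⟨k, rfl⟩ : ∃ k, j = k + 1 := ⟨j - 1, by omega⟩
        exact Or.inr ⟨L' ++ [k], a, r, snoc hL' (by omega), har, by simp; omega,
          by simp [hp.descProd_mul_of_mem (show a ≤ k by omega) (show k + 1 < a + r by omega),
            mul_assoc]⟩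

/-- Words in `m` crossings that are longer than `m * (m + 1) / 2` vanish. -/
lemma prod_eq_zero_of_length (m : ℕ) (L : List ℕ) (hL : ∀ j ∈ L, j < m)
    (hlen : m * (m + 1) < 2 * L.length) : (L.map p).prod = 0 := by
  induction m generalizing L with
  | zero =>
    cases L with
    | nil => simp at hlen
    | cons j L => exact absurd (hL j (by simp)) (by omega)
  | succ m ih =>
    obtain h | ⟨L', a, r, hL', har, hlen', h⟩ := hp.prod_eq_zero_or_factor m L hL
    · exact h
    · rw [h, ih L' hL' (by nlinarith), zero_mul]

end IsNilCoxeter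

end NilCoxeter

/-! ### Length of words representing the longest permutation -/

/-- The inversions of a permutation. -/
def invSet {n : ℕ} (w : Equiv.Perm (Fin n)) : Finset (Fin n × Fin n) :=
  Finset.univ.filter fun q => q.1 < q.2 ∧ w q.2 < w q.1

lemma mem_invSet {n : ℕ} {w : Equiv.Perm (Fin n)} {q : Fin n × Fin n} :
    q ∈ invSet w ↔ q.1 < q.2 ∧ w q.2 < w q.1 := by
  simp [invSet]

lemma invSet_sSwap_mul_subset {n : ℕ} (j : Fin (n - 1)) (w : Equiv.Perm (Fin n)) :
    invSet (sSwap j * w) ⊆ insert (w.symm (lpos j), w.symm (rpos j)) (invSet w) := by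
  rintro ⟨a, b⟩ h
  simp only [mem_invSet, Finset.mem_insert,
    Equiv.Perm.mul_apply, Prod.mk.injEq, Equiv.eq_symm_apply] at h ⊢
  obtain ⟨hab, h⟩ := h
  simp only [sSwap, Equiv.swap_apply_def] at h
  simp only [lpos, rpos] at h ⊢
  have hne : w a ≠ w b := fun e => hab.ne (w.injective e)
  generalize w a = u at *
  generalize w b = v at *
  simp only [Fin.ext_iff, Fin.lt_def, apply_ite Fin.val, Fin.val_castLE] at *
  split_ifs at h <;> omega

lemma card_invSet_prod_le {n : ℕ} (L : List (Fin (n - 1))) :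
    (invSet (L.map sSwap).prod).card ≤ L.length := by
  induction L with
  | nil =>
    simp only [List.map_nil, List.prod_nil, List.length_nil, Nat.le_zero, Finset.card_eq_zero]
    ext q
    simpa [mem_invSet] using fun h : q.1 < q.2 => h.le
  | cons j L ih =>
    rw [List.map_cons, List.prod_cons, List.length_cons]
    exact (Finset.card_le_card (invSet_sSwap_mul_subset j _)).trans
      ((Finset.card_insert_le _ _).trans (by omega))

lemma two_mul_card_invSet_revPerm (n : ℕ) :
    2 * (invSet (Fin.revPerm : Equiv.Perm (Fin n))).card = n * (n - 1) := by
  have h : invSet (Fin.revPerm : Equiv.Perm (Fin n)) =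
      (Finset.univ.sigma fun b : Fin n => Finset.Iio b).map
        ⟨fun q => (q.2, q.1), fun q q' h => by
          cases q; cases q'; simp_all⟩ := by
    ext ⟨a, b⟩
    simp only [mem_invSet, Fin.revPerm_apply, Fin.rev_lt_rev, and_self, Finset.mem_map,
      Finset.mem_sigma, Finset.mem_univ, Finset.mem_Iio, true_and]
    exact ⟨fun h => ⟨⟨b, a⟩, h, rfl⟩, by rintro ⟨q, h, ⟨⟩⟩; exact h⟩
  rw [h, Finset.card_map, Finset.card_sigma]
  simp only [Fin.card_Iio]
  rw [Fin.sum_univ_eq_sum_range (fun i => i), mul_comm, Finset.sum_range_id_mul_two]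

lemma le_two_mul_length_of_prod_eq_revPerm {n : ℕ} {L : List (Fin (n - 1))}
    (hL : (L.map sSwap).prod = (Fin.revPerm : Equiv.Perm (Fin n))) :
    n * (n - 1) ≤ 2 * L.length := by
  rw [← two_mul_card_invSet_revPerm, ← hL]
  exact Nat.mul_le_mul_left 2 (card_invSet_prod_le L)

/-! ### Relations in the nilHecke algebra -/

section Relations

variable {𝕜 : Type} [Field 𝕜] {n : ℕ}

lemma nhMk_eq_of_rel {a b : FreeAlgebra 𝕜 (NHGen n)} (h : NHRel 𝕜 n a b) :
    nhMk 𝕜 n a = nhMk 𝕜 n b :=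
  RingQuot.mkAlgHom_rel 𝕜 h

lemma xN_mul_xN (j k : Fin n) : xN 𝕜 n j * xN 𝕜 n k = xN 𝕜 n k * xN 𝕜 n j := by
  simpa [xN] using nhMk_eq_of_rel (NHRel.xx (𝕜 := 𝕜) j k)

lemma pN_mul_xN_of_ne (j : Fin (n - 1)) (k : Fin n) (h1 : k ≠ lpos j) (h2 : k ≠ rpos j) :
    pN 𝕜 n j * xN 𝕜 n k = xN 𝕜 n k * pN 𝕜 n j := by
  simpa [xN, pN] using nhMk_eq_of_rel (NHRel.psix (𝕜 := 𝕜) j k h1 h2)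

lemma pN_mul_xN_lpos (j : Fin (n - 1)) :
    pN 𝕜 n j * xN 𝕜 n (lpos j) = xN 𝕜 n (rpos j) * pN 𝕜 n j + 1 := by
  have := nhMk_eq_of_rel (NHRel.dot2 (𝕜 := 𝕜) j)
  simp only [map_sub, map_mul, map_one] at this
  exact sub_eq_iff_eq_add'.1 this

lemma pN_mul_xN_rpos (j : Fin (n - 1)) :
    pN 𝕜 n j * xN 𝕜 n (rpos j) = xN 𝕜 n (lpos j) * pN 𝕜 n j - 1 := by
  have := nhMk_eq_of_rel (NHRel.dot1 (𝕜 := 𝕜) j)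
  simp only [map_sub, map_mul, map_one] at this
  exact eq_sub_of_add_eq' (sub_eq_iff_eq_add.1 this).symm

variable (𝕜 n) in
/-- The crossings as a sequence indexed by `ℕ`, vanishing out of range. -/
def pNat (k : ℕ) : NH 𝕜 n := if h : k < n - 1 then pN 𝕜 n ⟨k, h⟩ else 0

lemma pNat_val (j : Fin (n - 1)) : pNat 𝕜 n j = pN 𝕜 n j := by simp [pNat]

lemma isNilCoxeter_pNat : IsNilCoxeter (pNat 𝕜 n) where
  sq j := by
    unfold pNat
    split_ifs with h
    · simpa [pN] using nhMk_eq_of_rel (NHRel.psisq (𝕜 := 𝕜) (n := n) ⟨j, h⟩)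
    · simp
  comm j k hjk := by
    unfold pNat
    split_ifs with h h'
    · simpa [pN] using nhMk_eq_of_rel (NHRel.psipsi (𝕜 := 𝕜) (n := n) ⟨j, h⟩ ⟨k, h'⟩ hjk)
    all_goals simp
  braid j := by
    unfold pNat
    split_ifs with h h'
    · simpa [pN] using nhMk_eq_of_rel (NHRel.braid (𝕜 := 𝕜) (n := n) ⟨j, h⟩ ⟨j + 1, h'⟩ rfl)
    all_goals simp

/-- A crossing annihilates every word representing the longest permutation. -/
lemma pN_mul_prod_eq_zero {L : List (Fin (n - 1))}
    (hL : (L.map sSwap).prod = (Fin.revPerm : Equiv.Perm (Fin n))) (j : Fin (n - 1)) :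
    pN 𝕜 n j * (L.map (pN 𝕜 n)).prod = 0 := by
  have hlen := le_two_mul_length_of_prod_eq_revPerm hL
  have hn : n - 1 + 1 = n := by have := j.isLt; omega
  have := (isNilCoxeter_pNat (𝕜 := 𝕜) (n := n)).prod_eq_zero_of_length (n - 1)
    ((j :: L).map Fin.val) (by simp only [List.mem_map]; rintro _ ⟨i, -, rfl⟩; exact i.isLt)
    (by rw [hn, mul_comm]; simp only [List.length_map, List.length_cons]; omega)
  simpa [Function.comp_def, pNat_val] using this

open scoped IsMulCommutative in
lemma exists_algHom_of_commute {σ A : Type*} [Semiring A] [Algebra 𝕜 A] (x : σ → A)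
    (hx : ∀ i j, x i * x j = x j * x i) :
    ∃ φ : MvPolynomial σ 𝕜 →ₐ[𝕜] A, ∀ i, φ (MvPolynomial.X i) = x i := by
  have := Algebra.isMulCommutative_adjoin 𝕜 (s := Set.range x)
    (by rintro _ ⟨i, rfl⟩ _ ⟨j, rfl⟩; exact hx i j)
  let y (i : σ) : Algebra.adjoin 𝕜 (Set.range x) := ⟨x i, Algebra.subset_adjoin ⟨i, rfl⟩⟩
  exact ⟨(Algebra.adjoin 𝕜 (Set.range x)).val.comp (MvPolynomial.aeval y), fun i => by simp [y]⟩

variable (𝕜 n) in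
/-- The map from polynomials to the nilHecke algebra sending variables to dots. -/
def polyHom : MvPolynomial (Fin n) 𝕜 →ₐ[𝕜] NH 𝕜 n :=
  (exists_algHom_of_commute (xN 𝕜 n) xN_mul_xN).choose

@[simp]
lemma polyHom_X (i : Fin n) : polyHom 𝕜 n (MvPolynomial.X i) = xN 𝕜 n i :=
  (exists_algHom_of_commute (xN 𝕜 n) xN_mul_xN).choose_spec i

lemma exists_pN_mul_polyHom (j : Fin (n - 1)) (p : MvPolynomial (Fin n) 𝕜) :
    ∃ q r, pN 𝕜 n j * polyHom 𝕜 n p = polyHom 𝕜 n q * pN 𝕜 n j + polyHom 𝕜 n r := by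
  induction p using MvPolynomial.induction_on with
  | C c =>
    refine ⟨MvPolynomial.C c, 0, ?_⟩
    rw [MvPolynomial.algHom_C, map_zero, add_zero, Algebra.commutes]
  | add p p' h h' =>
    obtain ⟨q, r, h⟩ := h
    obtain ⟨q', r', h'⟩ := h'
    refine ⟨q + q', r + r', ?_⟩
    simp only [map_add, mul_add, add_mul, h, h']
    abel
  | mul_X p i h =>
    obtain ⟨q, r, h⟩ := h
    have hx : ∃ (k : Fin n) (c : MvPolynomial (Fin n) 𝕜),
        pN 𝕜 n j * xN 𝕜 n i = xN 𝕜 n k * pN 𝕜 n j + polyHom 𝕜 n c := by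
      by_cases h1 : i = lpos j
      · exact ⟨rpos j, 1, by rw [h1, pN_mul_xN_lpos, map_one]⟩
      by_cases h2 : i = rpos j
      · exact ⟨lpos j, -1, by rw [h2, pN_mul_xN_rpos, map_neg, map_one, sub_eq_add_neg]⟩
      exact ⟨i, 0, by rw [pN_mul_xN_of_ne j i h1 h2, map_zero, add_zero]⟩
    obtain ⟨k, c, hx⟩ := hx
    refine ⟨q * MvPolynomial.X k, q * c + r * MvPolynomial.X i, ?_⟩
    simp only [map_mul, map_add, polyHom_X]
    rw [← mul_assoc, h, add_mul, mul_assoc, hx]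
    simp only [mul_add, mul_assoc, add_assoc]

/-- The left ideal generated by `ψ_{w_0}` consists of its polynomial multiples. -/
lemma exists_mul_eq_polyHom_mul {Ψ : NH 𝕜 n} (hΨ : ∀ j, pN 𝕜 n j * Ψ = 0) (a : NH 𝕜 n) :
    ∃ p, a * Ψ = polyHom 𝕜 n p * Ψ := by
  obtain ⟨a, rfl⟩ := RingQuot.mkAlgHom_surjective 𝕜 (NHRel 𝕜 n) a
  change ∃ p, nhMk 𝕜 n a * Ψ = _
  suffices h : ∀ q, ∃ p, nhMk 𝕜 n a * (polyHom 𝕜 n q * Ψ) = polyHom 𝕜 n p * Ψ by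
    simpa using h 1
  induction a using FreeAlgebra.induction with
  | grade0 c =>
    intro q
    refine ⟨MvPolynomial.C c * q, ?_⟩
    rw [map_mul, MvPolynomial.algHom_C, AlgHom.commutes, mul_assoc]
  | grade1 g =>
    intro q
    cases g with
    | x i =>
      refine ⟨MvPolynomial.X i * q, ?_⟩
      rw [map_mul, polyHom_X, mul_assoc]
      rfl
    | psi j =>
      obtain ⟨q', r, h⟩ := exists_pN_mul_polyHom j q
      refine ⟨r, ?_⟩
      change pN 𝕜 n j * _ = _
      rw [← mul_assoc, h, add_mul, mul_assoc, hΨ, mul_zero, zero_add]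
  | mul a b ha hb =>
    intro q
    obtain ⟨p, hp⟩ := hb q
    obtain ⟨p', hp'⟩ := ha p
    exact ⟨p', by rw [map_mul, mul_assoc, hp, hp']⟩
  | add a b ha hb =>
    intro q
    obtain ⟨p, hp⟩ := hb q
    obtain ⟨p', hp'⟩ := ha q
    exact ⟨p' + p, by rw [map_add, add_mul, hp, hp', map_add, add_mul]⟩

end Relations

/-! ### The action by divided differences on rational functions -/

section Action

variable (𝕜 : Type) [Field 𝕜] (n : ℕ)

/-- The field of rational functions in `n` variables. -/
abbrev RatFun := FractionRing (MvPolynomial (Fin n) 𝕜)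

variable {n} in
/-- The variables of the field of rational functions. -/
def ratX (i : Fin n) : RatFun 𝕜 n := algebraMap (MvPolynomial (Fin n) 𝕜) _ (MvPolynomial.X i)

variable {n} in
lemma ratX_injective : Function.Injective (ratX 𝕜 : Fin n → RatFun 𝕜 n) :=
  (IsFractionRing.injective _ _).comp MvPolynomial.X_injective

lemma lpos_ne_rpos {n : ℕ} (j : Fin (n - 1)) : lpos j ≠ rpos j := by
  simp [lpos, rpos, Fin.ext_iff]

/-- The action of permutations of the variables on rational functions. -/
def permAct : Equiv.Perm (Fin n) →* (RatFun 𝕜 n ≃ₐ[𝕜] RatFun 𝕜 n) :=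
  (IsFractionRing.fieldEquivOfAlgEquivHom 𝕜 (RatFun 𝕜 n)).comp
    { toFun := MvPolynomial.renameEquiv 𝕜
      map_one' := MvPolynomial.renameEquiv_refl 𝕜
      map_mul' := fun v w => (MvPolynomial.renameEquiv_trans 𝕜 w v).symm }

variable {𝕜 n}

@[simp]
lemma permAct_ratX (w : Equiv.Perm (Fin n)) (i : Fin n) :
    permAct 𝕜 n w (ratX 𝕜 i) = ratX 𝕜 (w i) := by
  simp [permAct, ratX]

lemma permAct_swap_swap (a b : Fin n) (u : RatFun 𝕜 n) :
    permAct 𝕜 n (Equiv.swap a b) (permAct 𝕜 n (Equiv.swap a b) u) = u := by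
  rw [← AlgEquiv.mul_apply, ← map_mul, Equiv.swap_mul_self, map_one, AlgEquiv.one_apply]

lemma ratX_sub_ne_zero {a b : Fin n} (h : a ≠ b) : ratX 𝕜 a - ratX 𝕜 b ≠ 0 :=
  sub_ne_zero.2 fun e => h (ratX_injective 𝕜 e)

variable (𝕜) in
/-- The divided difference operator exchanging the variables `a` and `b`. -/
def divDiff (a b : Fin n) : Module.End 𝕜 (RatFun 𝕜 n) :=
  LinearMap.mulLeft 𝕜 (ratX 𝕜 a - ratX 𝕜 b)⁻¹ *
    (1 - (permAct 𝕜 n (Equiv.swap a b)).toLinearMap)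

lemma divDiff_apply (a b : Fin n) (u : RatFun 𝕜 n) :
    divDiff 𝕜 a b u =
      (ratX 𝕜 a - ratX 𝕜 b)⁻¹ * (u - permAct 𝕜 n (Equiv.swap a b) u) := by
  simp [divDiff]

lemma divDiff_divDiff {a b : Fin n} (h : a ≠ b) (u : RatFun 𝕜 n) :
    divDiff 𝕜 a b (divDiff 𝕜 a b u) = 0 := by
  have h1 := ratX_sub_ne_zero (𝕜 := 𝕜) h
  have h2 := ratX_sub_ne_zero (𝕜 := 𝕜) h.symm
  simp only [divDiff_apply, map_mul, map_sub, map_inv₀, permAct_ratX, permAct_swap_swap,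
    Equiv.swap_apply_left, Equiv.swap_apply_right]
  field_simp
  ring

lemma divDiff_comm {a b c d : Fin n} (hac : a ≠ c) (had : a ≠ d) (hbc : b ≠ c) (hbd : b ≠ d)
    (u : RatFun 𝕜 n) :
    divDiff 𝕜 a b (divDiff 𝕜 c d u) = divDiff 𝕜 c d (divDiff 𝕜 a b u) := by
  have hs : permAct 𝕜 n (Equiv.swap a b) (permAct 𝕜 n (Equiv.swap c d) u) =
      permAct 𝕜 n (Equiv.swap c d) (permAct 𝕜 n (Equiv.swap a b) u) := by
    simp only [← AlgEquiv.mul_apply, ← map_mul]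
    congr 2
    ext i
    simp only [Equiv.Perm.mul_apply, Equiv.swap_apply_def]
    grind
  simp only [divDiff_apply, map_mul, map_sub, map_inv₀, permAct_ratX, hs,
    Equiv.swap_apply_of_ne_of_ne hac.symm hbc.symm, Equiv.swap_apply_of_ne_of_ne had.symm hbd.symm,
    Equiv.swap_apply_of_ne_of_ne hac had, Equiv.swap_apply_of_ne_of_ne hbc hbd]
  ring

lemma divDiff_braid {a b c : Fin n} (hab : a ≠ b) (hac : a ≠ c) (hbc : b ≠ c)
    (u : RatFun 𝕜 n) :
    divDiff 𝕜 a b (divDiff 𝕜 b c (divDiff 𝕜 a b u)) =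
      divDiff 𝕜 b c (divDiff 𝕜 a b (divDiff 𝕜 b c u)) := by
  have hs : permAct 𝕜 n (Equiv.swap a b)
        (permAct 𝕜 n (Equiv.swap b c) (permAct 𝕜 n (Equiv.swap a b) u)) =
      permAct 𝕜 n (Equiv.swap b c)
        (permAct 𝕜 n (Equiv.swap a b) (permAct 𝕜 n (Equiv.swap b c) u)) := by
    simp only [← AlgEquiv.mul_apply, ← map_mul]
    congr 2
    ext i
    simp only [Equiv.Perm.mul_apply, Equiv.swap_apply_def]
    grind
  have h1 := ratX_sub_ne_zero (𝕜 := 𝕜) hab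
  have h2 := ratX_sub_ne_zero (𝕜 := 𝕜) hab.symm
  have h3 := ratX_sub_ne_zero (𝕜 := 𝕜) hac
  have h4 := ratX_sub_ne_zero (𝕜 := 𝕜) hac.symm
  have h5 := ratX_sub_ne_zero (𝕜 := 𝕜) hbc
  have h6 := ratX_sub_ne_zero (𝕜 := 𝕜) hbc.symm
  simp only [divDiff_apply, map_mul, map_sub, map_inv₀, permAct_ratX, permAct_swap_swap,
    Equiv.swap_apply_left, Equiv.swap_apply_right, hs,
    Equiv.swap_apply_of_ne_of_ne hac.symm hbc.symm, Equiv.swap_apply_of_ne_of_ne hab hac]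
  field_simp
  ring

variable (𝕜 n) in
/-- The operators by which the generators act on rational functions. -/
def genAct : NHGen n → Module.End 𝕜 (RatFun 𝕜 n)
  | .x j => LinearMap.mulLeft 𝕜 (ratX 𝕜 j)
  | .psi j => divDiff 𝕜 (lpos j) (rpos j)

lemma lift_genAct_eq_of_rel {a b : FreeAlgebra 𝕜 (NHGen n)} (h : NHRel 𝕜 n a b) :
    FreeAlgebra.lift 𝕜 (genAct 𝕜 n) a = FreeAlgebra.lift 𝕜 (genAct 𝕜 n) b := by
  ext u
  induction h with
  | xx j k =>
    simp [XNf, genAct, mul_left_comm]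
  | psix j k h1 h2 =>
    simp [XNf, PNf, genAct, divDiff_apply, Equiv.swap_apply_of_ne_of_ne h1 h2]
    ring
  | psipsi j k h =>
    simp only [PNf, genAct, map_mul, FreeAlgebra.lift_ι_apply, Module.End.mul_apply]
    apply divDiff_comm <;> simp [lpos, rpos, Fin.ext_iff] <;> omega
  | psisq j =>
    simp [PNf, genAct, divDiff_divDiff (lpos_ne_rpos j)]
  | braid j k h =>
    have hjk : lpos k = rpos j := by simp [lpos, rpos, Fin.ext_iff, h]
    simp only [PNf, genAct, map_mul, FreeAlgebra.lift_ι_apply, Module.End.mul_apply, hjk]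
    apply divDiff_braid <;> simp [lpos, rpos, Fin.ext_iff] <;> omega
  | dot1 j =>
    have h1 := ratX_sub_ne_zero (𝕜 := 𝕜) (lpos_ne_rpos j)
    simp [XNf, PNf, genAct, divDiff_apply]
    field_simp
    ring
  | dot2 j =>
    have h1 := ratX_sub_ne_zero (𝕜 := 𝕜) (lpos_ne_rpos j)
    simp [XNf, PNf, genAct, divDiff_apply]
    field_simp
    ring

variable (𝕜 n) in
/-- The representation of the nilHecke algebra on rational functions. -/
def ratRep : NH 𝕜 n →ₐ[𝕜] Module.End 𝕜 (RatFun 𝕜 n) :=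
  RingQuot.liftAlgHom 𝕜 ⟨FreeAlgebra.lift 𝕜 (genAct 𝕜 n), fun _ _ => lift_genAct_eq_of_rel⟩

lemma ratRep_xN (j : Fin n) : ratRep 𝕜 n (xN 𝕜 n j) = LinearMap.mulLeft 𝕜 (ratX 𝕜 j) := by
  simp [ratRep, xN, nhMk, XNf, genAct]

lemma ratRep_pN (j : Fin (n - 1)) : ratRep 𝕜 n (pN 𝕜 n j) = divDiff 𝕜 (lpos j) (rpos j) := by
  simp [ratRep, pN, nhMk, PNf, genAct]

lemma ratRep_polyHom (p : MvPolynomial (Fin n) 𝕜) (u : RatFun 𝕜 n) :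
    ratRep 𝕜 n (polyHom 𝕜 n p) u = algebraMap _ (RatFun 𝕜 n) p * u := by
  have h : (ratRep 𝕜 n).comp (polyHom 𝕜 n) = (Algebra.lmul 𝕜 (RatFun 𝕜 n)).comp
      (IsScalarTower.toAlgHom 𝕜 (MvPolynomial (Fin n) 𝕜) (RatFun 𝕜 n)) := by
    apply MvPolynomial.algHom_ext
    intro i
    ext v
    simp [ratRep_xN, ratX]
  exact LinearMap.congr_fun (DFunLike.congr_fun h p) u

/-! ### Words acting as twisted combinations of permutations -/

variable (𝕜) in
/-- The coefficients of a word of divided differences as a combination of permutations. -/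
def wordCoeff : List (Fin (n - 1)) → Equiv.Perm (Fin n) → RatFun 𝕜 n
  | [], w => if w = 1 then 1 else 0
  | j :: L, w => (ratX 𝕜 (lpos j) - ratX 𝕜 (rpos j))⁻¹ *
      (wordCoeff L w - permAct 𝕜 n (sSwap j) (wordCoeff L (sSwap j * w)))

lemma sSwap_mul_sSwap_mul (j : Fin (n - 1)) (w : Equiv.Perm (Fin n)) :
    sSwap j * (sSwap j * w) = w := by
  rw [sSwap, Equiv.swap_mul_self_mul]

lemma ratRep_word_apply (L : List (Fin (n - 1))) (u : RatFun 𝕜 n) :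
    ratRep 𝕜 n (L.map (pN 𝕜 n)).prod u = ∑ w, wordCoeff 𝕜 L w * permAct 𝕜 n w u := by
  induction L with
  | nil => simp [wordCoeff]
  | cons j L ih =>
    have h : ∑ w, permAct 𝕜 n (sSwap j) (wordCoeff 𝕜 L (sSwap j * w)) * permAct 𝕜 n w u =
        ∑ w, permAct 𝕜 n (sSwap j) (wordCoeff 𝕜 L w * permAct 𝕜 n w u) := by
      rw [← Equiv.sum_comp (Equiv.mulLeft (sSwap j))]
      simp [sSwap_mul_sSwap_mul]
    rw [List.map_cons, List.prod_cons, map_mul, Module.End.mul_apply, ih, ratRep_pN,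
      divDiff_apply, ← sSwap, map_sum, ← h, ← Finset.sum_sub_distrib, Finset.mul_sum]
    refine Finset.sum_congr rfl fun w _ => ?_
    rw [wordCoeff]
    ring

lemma exists_word_of_wordCoeff_ne_zero {L : List (Fin (n - 1))} {w : Equiv.Perm (Fin n)}
    (h : wordCoeff 𝕜 L w ≠ 0) :
    ∃ L' : List (Fin (n - 1)), (L'.map sSwap).prod = w ∧ L'.length ≤ L.length := by
  induction L generalizing w with
  | nil =>
    obtain rfl : w = 1 := by
      by_contra hw
      simp [wordCoeff, hw] at h
    exact ⟨[], rfl, le_rfl⟩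
  | cons j L ih =>
    by_cases h1 : wordCoeff 𝕜 L w = 0
    · by_cases h2 : wordCoeff 𝕜 L (sSwap j * w) = 0
      · simp [wordCoeff, h1, h2] at h
      · obtain ⟨L', hL', hlen⟩ := ih h2
        exact ⟨j :: L', by simp [hL', sSwap_mul_sSwap_mul], by simpa using hlen⟩
    · obtain ⟨L', hL', hlen⟩ := ih h1
      exact ⟨L', hL', hlen.trans (by simp)⟩

lemma wordCoeff_prod_ne_zero {L : List (Fin (n - 1))}
    (hred : ∀ L' : List (Fin (n - 1)),
      (L'.map sSwap).prod = (L.map sSwap).prod → L.length ≤ L'.length) :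
    wordCoeff 𝕜 L (L.map sSwap).prod ≠ 0 := by
  induction L with
  | nil => simp [wordCoeff]
  | cons j L ih =>
    have hL : wordCoeff 𝕜 L (L.map sSwap).prod ≠ 0 := ih fun L' hL' => by
      simpa using hred (j :: L') (by simp [hL'])
    have hjL : wordCoeff 𝕜 L (sSwap j * (L.map sSwap).prod) = 0 := by
      by_contra h
      obtain ⟨L', hL', hlen⟩ := exists_word_of_wordCoeff_ne_zero h
      have := hred L' (by simpa using hL')
      simp only [List.length_cons] at this
      omega
    rw [List.map_cons, List.prod_cons, wordCoeff, hjL, sSwap_mul_sSwap_mul, zero_sub]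
    exact mul_ne_zero (inv_ne_zero (ratX_sub_ne_zero (lpos_ne_rpos j)))
      (neg_ne_zero.2 ((map_ne_zero _).2 hL))

lemma permAct_injective :
    Function.Injective fun w => ((permAct 𝕜 n w : RatFun 𝕜 n ≃ₐ[𝕜] RatFun 𝕜 n) :
      RatFun 𝕜 n →* RatFun 𝕜 n) := by
  intro v w h
  ext i
  have := DFunLike.congr_fun h (ratX 𝕜 i)
  simp only [MonoidHom.coe_coe, permAct_ratX] at this
  rw [ratX_injective 𝕜 this]

/-- A reduced word acts by a nonzero operator. -/
lemma exists_ratRep_word_ne_zero {L : List (Fin (n - 1))}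
    (hred : ∀ L' : List (Fin (n - 1)),
      (L'.map sSwap).prod = (L.map sSwap).prod → L.length ≤ L'.length) :
    ∃ u, ratRep 𝕜 n (L.map (pN 𝕜 n)).prod u ≠ 0 := by
  by_contra! h
  have hli := (linearIndependent_monoidHom (RatFun 𝕜 n) (RatFun 𝕜 n)).comp _
    (permAct_injective (𝕜 := 𝕜) (n := n))
  refine wordCoeff_prod_ne_zero hred (Fintype.linearIndependent_iff.1 hli (wordCoeff 𝕜 L) ?_ _)
  ext u
  simpa [ratRep_word_apply] using h u

end Action

variable (𝕜 : Type) [Field 𝕜] (n : ℕ) in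
lemma exists_nhDots_eq_polyHom : ∃ p ≠ 0, nhDots 𝕜 n = polyHom 𝕜 n p := by
  refine ⟨((List.finRange n).map fun j => MvPolynomial.X j ^ (n - 1 - j.val)).prod, ?_, ?_⟩
  · refine List.prod_ne_zero fun h => ?_
    obtain ⟨j, -, hj⟩ := List.mem_map.1 h
    exact pow_ne_zero _ (MvPolynomial.X_ne_zero j) hj
  · simp [nhDots, map_list_prod, Function.comp_def]

/-- `e_n = x_1^{n−1} x_2^{n−2} ⋯ x_{n−1} ψ_{w_0}` is a primitive
idempotent of `NH_n`: it is nonzero and is not the sum of two nonzero orthogonal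
idempotents. -/
theorem e_n_primitive (𝕜 : Type) [Field 𝕜] (n : ℕ) (hn : 1 ≤ n)
    (L : List (Fin (n - 1)))
    (hL : (L.map sSwap).prod = (Fin.revPerm : Equiv.Perm (Fin n)))
    (hred : ∀ L' : List (Fin (n - 1)),
      (L'.map sSwap).prod = (Fin.revPerm : Equiv.Perm (Fin n)) → L.length ≤ L'.length) :
    nhE 𝕜 n L ≠ 0 ∧
    ¬ ∃ f g : NH 𝕜 n, f ≠ 0 ∧ g ≠ 0 ∧ f * f = f ∧ g * g = g ∧
        f * g = 0 ∧ g * f = 0 ∧ nhE 𝕜 n L = f + g := by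
  set Ψ := (L.map (pN 𝕜 n)).prod
  obtain ⟨d, hd, hdots⟩ := exists_nhDots_eq_polyHom 𝕜 n
  obtain ⟨u, hu⟩ : ∃ u, ratRep 𝕜 n Ψ u ≠ 0 := exists_ratRep_word_ne_zero (by rwa [hL])
  have act (p : MvPolynomial (Fin n) 𝕜) (v : RatFun 𝕜 n) : ratRep 𝕜 n (polyHom 𝕜 n p * Ψ) v =
      algebraMap _ (RatFun 𝕜 n) p * ratRep 𝕜 n Ψ v := by
    rw [map_mul, Module.End.mul_apply, ratRep_polyHom]
  have map_ne {p : MvPolynomial (Fin n) 𝕜} (hp : p ≠ 0) : algebraMap _ (RatFun 𝕜 n) p ≠ 0 :=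
    (map_ne_zero_iff _ (IsFractionRing.injective _ _)).2 hp
  have hE : nhE 𝕜 n L = polyHom 𝕜 n d * Ψ := by rw [nhE, hdots]
  refine ⟨fun h => ?_, ?_⟩
  · have := act d u
    rw [← hE, h, map_zero, LinearMap.zero_apply] at this
    exact mul_ne_zero (map_ne hd) hu this.symm
  · rintro ⟨f, g, hf, hg, hff, hgg, hfg, hgf, h⟩
    have left_ideal (a : NH 𝕜 n) : ∃ p, a * nhE 𝕜 n L = polyHom 𝕜 n p * Ψ := by
      rw [hE, ← mul_assoc]
      exact exists_mul_eq_polyHom_mul (pN_mul_prod_eq_zero hL) _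
    obtain ⟨p, hp⟩ := left_ideal f
    obtain ⟨q, hq⟩ := left_ideal g
    rw [h, mul_add, hff, hfg, add_zero] at hp
    rw [h, mul_add, hgf, hgg, zero_add] at hq
    have hp0 : p ≠ 0 := by rintro rfl; exact hf (by simpa using hp)
    have hq0 : q ≠ 0 := by rintro rfl; exact hg (by simpa using hq)
    have hgu : ratRep 𝕜 n g u ≠ 0 := by
      rw [hq, act]
      exact mul_ne_zero (map_ne hq0) hu
    have hfgu : ratRep 𝕜 n f (ratRep 𝕜 n g u) = 0 := by
      rw [← Module.End.mul_apply, ← map_mul, hfg, map_zero, LinearMap.zero_apply]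
    have hggu : ratRep 𝕜 n g (ratRep 𝕜 n g u) = ratRep 𝕜 n g u := by
      rw [← Module.End.mul_apply, ← map_mul, hgg]
    rw [hp, act] at hfgu
    have hΨgu := (mul_eq_zero.1 hfgu).resolve_left (map_ne hp0)
    refine hgu (hggu.symm.trans ?_)
    generalize ratRep 𝕜 n g u = v at hΨgu
    rw [hq, act, hΨgu, mul_zero]

end Statement56

end
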